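/- arXiv:1604.02772 — 2 statements merged into one kernel-verified Lean document; each statement's English description precedes it below -/
import Mathlib

section
/- Let θ, κ ∈ ℝ and a, b ∈ ℂ with |a| < 1 and |b| < 1, and for λ ∈ ℝ \ {0} set E₊(θ,a,λ) = (1+|a|²λ²)^{-1/2} · [[e^{iθ}, aλ], [-conj(a)λ, e^{-iθ}]] and E₋(κ,b,λ) = (1+|b|²λ^{-2})^{-1/2} · [[e^{iκ}, bλ^{-1}], [-conj(b)λ^{-1}, e^{-iκ}]]. Then 1 - a·conj(b)·e^{-i(θ+κ)} ≠ 0, and for any real numbers θ̃, κ̃ satisfying θ̃ + κ̃ = θ + κ + 2·arg(1 - a·conj(b)·e^{-i(θ+κ)}), setting ã = a·e^{-i(κ+κ̃)} and b̃ = b·e^{i(θ+θ̃)}, one has |ã| = |a| < 1, |b̃| = |b| < 1, and the matrix identity E₊(θ,a,λ)·E₋(κ,b,λ) = E₋(κ̃,b̃,λ)·E₊(θ̃,ã,λ) holds for every λ ∈ ℝ \ {0}. -/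
open Matrix

/-- The "plus-type" factor `E₊(θ,a,λ)`. -/
noncomputable def Ep (θ : ℝ) (a : ℂ) (lam : ℝ) : Matrix (Fin 2) (Fin 2) ℂ :=
  (((Real.sqrt (1 + ‖a‖ ^ 2 * lam ^ 2))⁻¹ : ℝ) : ℂ) •
    !![Complex.exp (Complex.I * θ), a * lam;
       -(starRingEnd ℂ a) * lam, Complex.exp (-(Complex.I * θ))]

/-- The "minus-type" factor `E₋(κ,b,λ)`. -/
noncomputable def Em (κ : ℝ) (b : ℂ) (lam : ℝ) : Matrix (Fin 2) (Fin 2) ℂ :=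
  (((Real.sqrt (1 + ‖b‖ ^ 2 * ((lam : ℝ) ^ 2)⁻¹))⁻¹ : ℝ) : ℂ) •
    !![Complex.exp (Complex.I * κ), b * (lam : ℂ)⁻¹;
       -(starRingEnd ℂ b) * (lam : ℂ)⁻¹, Complex.exp (-(Complex.I * κ))]

/-- Lemma 3.1 of the paper: the swap `E₊E₋ = Ẽ₋Ẽ₊` with explicit new parameters. -/
theorem swap_lemma (θ κ : ℝ) (a b : ℂ)
    (ha : ‖a‖ < 1) (hb : ‖b‖ < 1) :
    1 - a * starRingEnd ℂ b * Complex.exp (-(Complex.I * (θ + κ))) ≠ 0 ∧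
    ∀ θt κt : ℝ,
      θt + κt =
        θ + κ + 2 * Complex.arg
          (1 - a * starRingEnd ℂ b * Complex.exp (-(Complex.I * (θ + κ)))) →
      ‖a * Complex.exp (-(Complex.I * (κ + κt)))‖ = ‖a‖ ∧
      ‖a * Complex.exp (-(Complex.I * (κ + κt)))‖ < 1 ∧
      ‖b * Complex.exp (Complex.I * (θ + θt))‖ = ‖b‖ ∧
      ‖b * Complex.exp (Complex.I * (θ + θt))‖ < 1 ∧
      ∀ lam : ℝ, lam ≠ 0 →
        Ep θ a lam * Em κ b lam =
          Em κt (b * Complex.exp (Complex.I * (θ + θt))) lam *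
            Ep θt (a * Complex.exp (-(Complex.I * (κ + κt)))) lam := by
  have hexp : ∀ x : ℝ, ‖Complex.exp (Complex.I * x)‖ = 1 := fun x => by
    rw [mul_comm]; exact Complex.norm_exp_ofReal_mul_I x
  have hexpn : ∀ x : ℝ, ‖Complex.exp (-(Complex.I * x))‖ = 1 := fun x => by
    rw [Complex.exp_neg, norm_inv, hexp, inv_one]
  have hconj : ∀ x : ℝ, starRingEnd ℂ (Complex.exp (Complex.I * x))
      = (Complex.exp (Complex.I * x))⁻¹ := fun x => by
    rw [← Complex.exp_conj, ← Complex.exp_neg]; simp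
  have hw : 1 - a * starRingEnd ℂ b * Complex.exp (-(Complex.I * (θ + κ))) ≠ 0 := by
    intro h
    have h1 : a * starRingEnd ℂ b * Complex.exp (-(Complex.I * (θ + κ))) = 1 :=
      (sub_eq_zero.mp h).symm
    have h2 := congrArg norm h1
    have h3 := hexpn (θ + κ)
    push_cast at h3
    rw [norm_mul, norm_mul, h3, RCLike.norm_conj, norm_one] at h2
    nlinarith [norm_nonneg a, norm_nonneg b]
  refine ⟨hw, ?_⟩
  intro θt κt hsum
  have hna : ‖a * Complex.exp (-(Complex.I * (κ + κt)))‖ = ‖a‖ := by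
    have h3 := hexpn (κ + κt)
    push_cast at h3
    rw [norm_mul, h3, mul_one]
  have hnb : ‖b * Complex.exp (Complex.I * (θ + θt))‖ = ‖b‖ := by
    have h3 := hexp (θ + θt)
    push_cast at h3
    rw [norm_mul, h3, mul_one]
  refine ⟨hna, hna ▸ ha, hnb, hnb ▸ hb, ?_⟩
  intro lam hlam
  have hl : (lam : ℂ) ≠ 0 := by exact_mod_cast hlam
  unfold Ep Em
  rw [hna, hnb]
  -- the key phase relation
  have hkey : Complex.exp (Complex.I * θt) * Complex.exp (Complex.I * κt) *
      starRingEnd ℂ (1 - a * starRingEnd ℂ b * Complex.exp (-(Complex.I * (θ + κ)))) =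
      Complex.exp (Complex.I * θ) * Complex.exp (Complex.I * κ) *
      (1 - a * starRingEnd ℂ b * Complex.exp (-(Complex.I * (θ + κ)))) := by
    generalize 1 - a * starRingEnd ℂ b * Complex.exp (-(Complex.I * (θ + κ))) = w at hsum
    have e1 : Complex.exp (Complex.I * θt) * Complex.exp (Complex.I * κt) =
        Complex.exp (Complex.I * θ) * Complex.exp (Complex.I * κ) *
          (Complex.exp (Complex.I * w.arg) * Complex.exp (Complex.I * w.arg)) := by
      rw [← Complex.exp_add, ← Complex.exp_add, ← Complex.exp_add, ← Complex.exp_add]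
      congr 1
      have h : (θt : ℂ) + κt = θ + κ + 2 * w.arg := by exact_mod_cast hsum
      linear_combination Complex.I * h
    have e2 : w = ‖w‖ * Complex.exp (Complex.I * w.arg) := by
      rw [mul_comm Complex.I]; exact (Complex.norm_mul_exp_arg_mul_I w).symm
    have e3 : starRingEnd ℂ w = ‖w‖ * (Complex.exp (Complex.I * w.arg))⁻¹ := by
      conv_lhs => rw [e2]
      rw [map_mul, hconj, Complex.conj_ofReal]
    have hne := Complex.exp_ne_zero (Complex.I * w.arg)
    rw [e1, e3]
    conv_rhs => rw [e2]
    field_simp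
  have x1 : Complex.exp (-(Complex.I * (θ + κ))) =
      (Complex.exp (Complex.I * θ))⁻¹ * (Complex.exp (Complex.I * κ))⁻¹ := by
    rw [← Complex.exp_neg, ← Complex.exp_neg, ← Complex.exp_add]; congr 1; ring
  have x2 : Complex.exp (-(Complex.I * (κ + κt))) =
      (Complex.exp (Complex.I * κ))⁻¹ * (Complex.exp (Complex.I * κt))⁻¹ := by
    rw [← Complex.exp_neg, ← Complex.exp_neg, ← Complex.exp_add]; congr 1; ring
  have x3 : Complex.exp (Complex.I * (θ + θt)) =
      Complex.exp (Complex.I * θ) * Complex.exp (Complex.I * θt) := by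
    rw [← Complex.exp_add]; congr 1; ring
  rw [x1] at hkey
  rw [x2, x3]
  simp only [Complex.exp_neg]
  simp only [map_sub, map_mul, map_inv₀, map_one, hconj, Complex.conj_conj, inv_inv] at hkey ⊢
  have n1 := Complex.exp_ne_zero (Complex.I * θ)
  have n2 := Complex.exp_ne_zero (Complex.I * κ)
  have n3 := Complex.exp_ne_zero (Complex.I * θt)
  have n4 := Complex.exp_ne_zero (Complex.I * κt)
  generalize Complex.exp (Complex.I * θ) = T at *
  generalize Complex.exp (Complex.I * κ) = K at *
  generalize Complex.exp (Complex.I * θt) = T' at *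
  generalize Complex.exp (Complex.I * κt) = K' at *
  generalize starRingEnd ℂ a = a' at *
  generalize starRingEnd ℂ b = b' at *
  rw [Matrix.smul_mul, Matrix.mul_smul, Matrix.smul_mul, Matrix.mul_smul, smul_comm]
  congr 2
  rw [Matrix.mul_fin_two, Matrix.mul_fin_two]
  have k2 : T' * K' * (1 - a' * b * (T * K)) = T * K - a * b' := by
    rw [hkey]; field_simp
  congr 1
  ext i j
  fin_cases i <;> fin_cases j <;> simp
  · field_simp
    linear_combination -k2
  · field_simp
    ring
  · field_simp
    ring
  · field_simp
    linear_combination k2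
end

section
/- Let θ, κ ∈ ℝ and a, b ∈ ℂ with |a| < 1 and |b| < 1, and let E₊, E₋ be as defined below. Then there exist κ̃ ∈ ℝ, θ̃ ∈ ℝ, ã, b̃ ∈ ℂ with |ã| = |a|, |b̃| = |b|, and κ̃ = 0, such that E₊(θ,a,λ)·E₋(κ,b,λ) = E₋(κ̃,b̃,λ)·E₊(θ̃,ã,λ) for all λ ∈ ℝ \ {0}; likewise there exists such a factorization with θ̃ = 0 instead of κ̃ = 0. -/
open Matrix

theorem swap_aux (θ κ κt θt : ℝ) (a b : ℂ)
    (h : Complex.exp (Complex.I * κt) * Complex.exp (Complex.I * θt) *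
      (1 - Complex.exp (Complex.I * θ) * Complex.exp (Complex.I * κ) * starRingEnd ℂ a * b) =
      Complex.exp (Complex.I * θ) * Complex.exp (Complex.I * κ) - a * starRingEnd ℂ b) :
    ∃ (at' bt : ℂ), ‖at'‖ = ‖a‖ ∧ ‖bt‖ = ‖b‖ ∧ ∀ lam : ℝ, lam ≠ 0 →
        Ep θ a lam * Em κ b lam = Em κt bt lam * Ep θt at' lam := by
  have hn : ∀ x : ℝ, ‖Complex.exp (Complex.I * x)‖ = 1 := fun x => by
    rw [mul_comm]; exact Complex.norm_exp_ofReal_mul_I x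
  have hn' : ∀ x : ℝ, ‖Complex.exp (-(Complex.I * x))‖ = 1 := fun x => by
    rw [Complex.exp_neg, norm_inv, hn, inv_one]
  have hc : ∀ x : ℝ, starRingEnd ℂ (Complex.exp (Complex.I * x)) =
      Complex.exp (-(Complex.I * x)) := fun x => by
    rw [← Complex.exp_conj]; simp
  have hc' : ∀ x : ℝ, starRingEnd ℂ (Complex.exp (-(Complex.I * x))) =
      Complex.exp (Complex.I * x) := fun x => by
    rw [← Complex.exp_conj]; simp
  have hm : ∀ x : ℝ, Complex.exp (Complex.I * x) * Complex.exp (-(Complex.I * x)) = 1 :=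
    fun x => by rw [← Complex.exp_add]; simp
  have hA : ‖a * Complex.exp (-(Complex.I * κ)) * Complex.exp (-(Complex.I * κt))‖ = ‖a‖ := by
    simp only [norm_mul, hn', mul_one]
  have hB : ‖Complex.exp (Complex.I * θ) * b * Complex.exp (Complex.I * θt)‖ = ‖b‖ := by
    simp only [norm_mul, hn, mul_one, one_mul]
  refine ⟨_, _, hA, hB, ?_⟩
  intro lam hlam
  have hl : (lam : ℂ) * (lam : ℂ)⁻¹ = 1 := mul_inv_cancel₀ (by exact_mod_cast hlam)
  have h2 := congrArg (starRingEnd ℂ) h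
  simp only [map_mul, map_sub, map_one, hc, Complex.conj_conj] at h2
  unfold Ep Em
  rw [hA, hB, Matrix.smul_mul, Matrix.mul_smul, Matrix.smul_mul, Matrix.mul_smul, smul_comm]
  congr 2
  simp only [map_mul, hc, hc']
  have m1 := hm θ
  have m2 := hm κ
  have m3 := hm κt
  have m4 := hm θt
  generalize Complex.exp (-(Complex.I * θ)) = u' at *
  generalize Complex.exp (-(Complex.I * κ)) = v' at *
  generalize Complex.exp (-(Complex.I * κt)) = V' at *
  generalize Complex.exp (-(Complex.I * θt)) = U' at *
  generalize Complex.exp (Complex.I * θ) = u at *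
  generalize Complex.exp (Complex.I * κ) = v at *
  generalize Complex.exp (Complex.I * κt) = V at *
  generalize Complex.exp (Complex.I * θt) = U at *
  generalize (lam : ℂ)⁻¹ = m at *
  generalize (lam : ℂ) = l at *
  generalize starRingEnd ℂ a = a' at *
  generalize starRingEnd ℂ b = b' at *
  rw [Matrix.mul_fin_two, Matrix.mul_fin_two]
  congr 1
  ext i j
  fin_cases i <;> fin_cases j <;> simp
  · linear_combination (-a * b' + u * b * U * a' * v * V) * hl - h
  · linear_combination (-a * l * v') * m3 - (u * b * m) * m4
  · linear_combination (a' * l * v) * m3 + (u' * b' * m) * m4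
  · linear_combination (-a' * b + u' * b' * U' * a * v' * V') * hl - h2

theorem omega_aux (θ κ : ℝ) (a b : ℂ) (ha : ‖a‖ < 1) (hb : ‖b‖ < 1) :
    ∃ ω : ℝ, Complex.exp (Complex.I * ω) *
      (1 - Complex.exp (Complex.I * θ) * Complex.exp (Complex.I * κ) * starRingEnd ℂ a * b) =
      Complex.exp (Complex.I * θ) * Complex.exp (Complex.I * κ) - a * starRingEnd ℂ b := by
  have hw : ‖Complex.exp (Complex.I * θ) * Complex.exp (Complex.I * κ)‖ = 1 := by
    rw [norm_mul, mul_comm Complex.I, mul_comm Complex.I, Complex.norm_exp_ofReal_mul_I,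
      Complex.norm_exp_ofReal_mul_I, one_mul]
  generalize Complex.exp (Complex.I * θ) * Complex.exp (Complex.I * κ) = w at *
  have hww : w * starRingEnd ℂ w = 1 := by
    rw [Complex.mul_conj, Complex.normSq_eq_norm_sq, hw]; simp
  have hz : 1 - w * starRingEnd ℂ a * b ≠ 0 := by
    intro h0
    have h1 : ‖w * starRingEnd ℂ a * b‖ = 1 := by
      rw [← sub_eq_zero.mp h0, norm_one]
    rw [norm_mul, norm_mul, hw, one_mul, Complex.norm_conj] at h1
    nlinarith [norm_nonneg a, norm_nonneg b]
  have he : w - a * starRingEnd ℂ b = w * starRingEnd ℂ (1 - w * starRingEnd ℂ a * b) := by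
    simp only [map_sub, map_mul, map_one, Complex.conj_conj]
    linear_combination (a * starRingEnd ℂ b) * hww
  rw [he]
  generalize 1 - w * starRingEnd ℂ a * b = z at *
  refine ⟨Complex.arg (w * starRingEnd ℂ z / z), ?_⟩
  have hN : ‖w * starRingEnd ℂ z / z‖ = 1 := by
    rw [norm_div, norm_mul, hw, Complex.norm_conj, one_mul, div_self (norm_ne_zero_iff.mpr hz)]
  have := Complex.norm_mul_exp_arg_mul_I (w * starRingEnd ℂ z / z)
  rw [hN, Complex.ofReal_one, one_mul] at this
  rw [mul_comm Complex.I, this, div_mul_cancel₀ _ hz]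

/-- Normalization remark in Lemma 3.1: in the factorization `E₊E₋ = Ẽ₋Ẽ₊` one can
always choose `κ̃ = 0`, and likewise one can always choose `θ̃ = 0`. -/
theorem swap_normalization (θ κ : ℝ) (a b : ℂ)
    (ha : ‖a‖ < 1) (hb : ‖b‖ < 1) :
    (∃ (κt θt : ℝ) (at' bt : ℂ),
      ‖at'‖ = ‖a‖ ∧
      ‖bt‖ = ‖b‖ ∧
      κt = 0 ∧
      ∀ lam : ℝ, lam ≠ 0 →
        Ep θ a lam * Em κ b lam = Em κt bt lam * Ep θt at' lam) ∧
    (∃ (κt θt : ℝ) (at' bt : ℂ),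
      ‖at'‖ = ‖a‖ ∧
      ‖bt‖ = ‖b‖ ∧
      θt = 0 ∧
      ∀ lam : ℝ, lam ≠ 0 →
        Ep θ a lam * Em κ b lam = Em κt bt lam * Ep θt at' lam) := by
  obtain ⟨ω, hω⟩ := omega_aux θ κ a b ha hb
  constructor
  · obtain ⟨A, B, h1, h2, h3⟩ := swap_aux θ κ 0 ω a b (by simpa using hω)
    exact ⟨0, ω, A, B, h1, h2, rfl, h3⟩
  · obtain ⟨A, B, h1, h2, h3⟩ := swap_aux θ κ ω 0 a b (by simpa using hω)
    exact ⟨ω, 0, A, B, h1, h2, rfl, h3⟩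
end
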